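/- Let ρ₀ ∈ [0, 1), β > 0, γ ≥ 1, and define ρ(P) = ρ₀ + β(P − 1)^γ and g(P) = (1 − ρ(P))/P + ρ(P) for real P > 1. Then g is twice differentiable on (1, ∞) with g″(P) = ρ″(P)(1 − 1/P) + 2ρ′(P)/P² + 2(1 − ρ(P))/P³, and g″(P) ≥ 0 for all P > 1; hence g is convex on (1, ∞). -/

import Mathlib

/-- Rising correlation model: ρ(P) = ρ₀ + β(P − 1)^γ (real exponent). -/
noncomputable def rhoFun (ρ₀ β γ P : ℝ) : ℝ := ρ₀ + β * (P - 1) ^ γ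

/-- Unnormalized variance factor: g(P) = (1 − ρ(P))/P + ρ(P). -/
noncomputable def gFun (ρ₀ β γ P : ℝ) : ℝ :=
  (1 - rhoFun ρ₀ β γ P) / P + rhoFun ρ₀ β γ P

/-- ρ′(P) = βγ(P − 1)^{γ−1}. -/
noncomputable def rhoDeriv (β γ P : ℝ) : ℝ := β * γ * (P - 1) ^ (γ - 1)

/-- ρ″(P) = βγ(γ − 1)(P − 1)^{γ−2}. -/
noncomputable def rhoDeriv2 (β γ P : ℝ) : ℝ := β * γ * (γ - 1) * (P - 1) ^ (γ - 2)

/-- g′(P) = ρ′(P)(1 − 1/P) − (1 − ρ(P))/P². -/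
noncomputable def gDeriv (ρ₀ β γ P : ℝ) : ℝ :=
  rhoDeriv β γ P * (1 - 1 / P) - (1 - rhoFun ρ₀ β γ P) / P ^ 2

/-- g″(P) = ρ″(P)(1 − 1/P) + 2ρ′(P)/P² + 2(1 − ρ(P))/P³. -/
noncomputable def gDeriv2 (ρ₀ β γ P : ℝ) : ℝ :=
  rhoDeriv2 β γ P * (1 - 1 / P) + 2 * rhoDeriv β γ P / P ^ 2
    + 2 * (1 - rhoFun ρ₀ β γ P) / P ^ 3

theorem hasDerivAt_rhoFun (ρ₀ β γ : ℝ) {P : ℝ} (hP : 1 < P) :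
    HasDerivAt (rhoFun ρ₀ β γ) (rhoDeriv β γ P) P := by
  have h := ((((hasDerivAt_id P).sub_const 1).rpow_const (p := γ)
    (Or.inl (sub_pos.2 hP).ne')).const_mul β).const_add ρ₀
  refine h.congr_deriv ?_
  simp only [rhoDeriv, id]
  ring

theorem hasDerivAt_rhoDeriv (β γ : ℝ) {P : ℝ} (hP : 1 < P) :
    HasDerivAt (rhoDeriv β γ) (rhoDeriv2 β γ P) P := by
  have h := (((hasDerivAt_id P).sub_const 1).rpow_const (p := γ - 1)
    (Or.inl (sub_pos.2 hP).ne')).const_mul (β * γ)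
  refine h.congr_deriv ?_
  have e : γ - 1 - 1 = γ - 2 := by ring
  simp only [rhoDeriv2, id, e]
  ring

theorem hasDerivAt_gFun (ρ₀ β γ : ℝ) {P : ℝ} (hP : 1 < P) :
    HasDerivAt (gFun ρ₀ β γ) (gDeriv ρ₀ β γ P) P := by
  have hP0 : P ≠ 0 := by positivity
  have hr := hasDerivAt_rhoFun ρ₀ β γ hP
  refine (((hr.const_sub 1).div (hasDerivAt_id P) hP0).add hr).congr_deriv ?_
  simp only [gDeriv, id]
  field_simp
  ring

theorem hasDerivAt_gDeriv (ρ₀ β γ : ℝ) {P : ℝ} (hP : 1 < P) :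
    HasDerivAt (gDeriv ρ₀ β γ) (gDeriv2 ρ₀ β γ P) P := by
  have hP0 : P ≠ 0 := by positivity
  have hr := hasDerivAt_rhoFun ρ₀ β γ hP
  have hd := hasDerivAt_rhoDeriv β γ hP
  have hi : HasDerivAt (fun x : ℝ => 1 - 1 / x) (1 / P ^ 2) P := by
    simpa [one_div] using (hasDerivAt_inv hP0).const_sub 1
  refine ((hd.mul hi).sub ((hr.const_sub 1).div (hasDerivAt_pow 2 P)
    (pow_ne_zero 2 hP0))).congr_deriv ?_
  simp only [gDeriv2]
  field_simp
  push_cast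
  ring

theorem gDeriv2_nonneg {ρ₀ β γ P : ℝ} (hρ₀ : ρ₀ ≤ 1) (hβ : 0 ≤ β) (hγ : 1 ≤ γ)
    (hP : 1 < P) : 0 ≤ gDeriv2 ρ₀ β γ P := by
  have hP0 : 0 < P := by positivity
  have hx : 0 < P - 1 := sub_pos.2 hP
  have e1 : (P - 1) ^ (γ - 1) = (P - 1) ^ (γ - 2) * (P - 1) := by
    rw [← Real.rpow_add_one hx.ne']
    ring_nf
  have e2 : (P - 1) ^ γ = (P - 1) ^ (γ - 2) * (P - 1) * (P - 1) := by
    rw [← Real.rpow_add_one hx.ne', ← Real.rpow_add_one hx.ne']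
    ring_nf
  have hy : 0 < (P - 1) ^ (γ - 2) := Real.rpow_pos_of_pos hx _
  simp only [gDeriv2, rhoDeriv2, rhoDeriv, rhoFun, e1, e2]
  generalize (P - 1) ^ (γ - 2) = y at hy
  have key : 0 ≤ γ * (γ - 1) * P ^ 2 + 2 * (γ * P - (P - 1)) := by
    have h1 : 0 ≤ γ * (γ - 1) * P ^ 2 :=
      mul_nonneg (mul_nonneg (by linarith) (by linarith)) (sq_nonneg P)
    nlinarith [mul_nonneg (sub_nonneg.2 hγ) hP0.le]
  have h : 0 ≤ (β * y * (P - 1) * (γ * (γ - 1) * P ^ 2 + 2 * (γ * P - (P - 1)))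
      + 2 * (1 - ρ₀)) / P ^ 3 := by
    have := mul_nonneg (mul_nonneg (mul_nonneg hβ hy.le) hx.le) key
    exact div_nonneg (by linarith) (by positivity)
  refine h.trans_eq ?_
  field_simp
  ring

/-- **Second derivative and convexity of the variance factor for γ ≥ 1:**
g is twice differentiable on (1, ∞) with the stated g″, g″ ≥ 0 there, and
g is convex on (1, ∞). -/
theorem gFun_convex (ρ₀ β γ : ℝ) (hρ₀ : ρ₀ ∈ Set.Ico (0 : ℝ) 1)
    (hβ : 0 < β) (hγ : 1 ≤ γ) :
    (∀ P : ℝ, 1 < P →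
      HasDerivAt (gFun ρ₀ β γ) (gDeriv ρ₀ β γ P) P ∧
      HasDerivAt (gDeriv ρ₀ β γ) (gDeriv2 ρ₀ β γ P) P ∧
      0 ≤ gDeriv2 ρ₀ β γ P) ∧
    ConvexOn ℝ (Set.Ioi (1 : ℝ)) (gFun ρ₀ β γ) := by
  have hnn : ∀ P : ℝ, 1 < P → 0 ≤ gDeriv2 ρ₀ β γ P :=
    fun P hP => gDeriv2_nonneg hρ₀.2.le hβ.le hγ hP
  refine ⟨fun P hP => ⟨hasDerivAt_gFun ρ₀ β γ hP, hasDerivAt_gDeriv ρ₀ β γ hP, hnn P hP⟩, ?_⟩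
  refine convexOn_of_hasDerivWithinAt2_nonneg (f' := gDeriv ρ₀ β γ) (f'' := gDeriv2 ρ₀ β γ)
    (convex_Ioi 1)
    (fun P hP => (hasDerivAt_gFun ρ₀ β γ hP).continuousAt.continuousWithinAt) ?_ ?_ ?_ <;>
    rw [interior_Ioi]
  · exact fun P hP => (hasDerivAt_gFun ρ₀ β γ hP).hasDerivWithinAt
  · exact fun P hP => (hasDerivAt_gDeriv ρ₀ β γ hP).hasDerivWithinAt
  · exact fun P hP => hnn P hP
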